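/- Let λ ∈ 𝔰'_n be a dominant n-tuple of r-th roots of unity with block sizes n_1,...,n_r. Then the subalgebra 1_λ Ĥ_{r,n} 1_λ of Ĥ_{r,n} is isomorphic as a Z[q,q^{-1}]-algebra to the tensor product Ĥ_{n_1} ⊗ ... ⊗ Ĥ_{n_r} of extended affine Hecke algebras of type A, via T_{s_i} ↦ g_{s_i} 1_λ for simple reflections s_i ∈ W_λ, Z_j^{±1} ↦ X_j^{±1} 1_λ, and 1 ↦ 1_λ. -/

import Mathlib

/-!
STATEMENT 11: Let `λ ∈ 𝔰'_n` be a dominant `n`-tuple of `r`-th roots of unity with block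
sizes `n_1,…,n_r`.  Then the subalgebra `1_λ Ĥ_{r,n} 1_λ` of `Ĥ_{r,n}` is isomorphic as a
`ℤ[q,q⁻¹]`-algebra to the tensor product `Ĥ_{n_1} ⊗ ⋯ ⊗ Ĥ_{n_r}` of extended affine Hecke
algebras of type `A`, via `T_{s_i} ↦ g_{s_i} 1_λ` (for the simple reflections `s_i ∈ W_λ`),
`Z_j^{±1} ↦ X_j^{±1} 1_λ`, and `1 ↦ 1_λ`.

`Ĥ_{r,n}` is presented over `𝒜 = ℤ[q,q⁻¹] = LaurentPolynomial ℤ` as in Statement 8.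
Dominance of `λ` (i.e. `λ ∈ 𝔰'_n`) means `λ : Fin n → Fin r` is monotone; then
`W_λ = S_{n_1} × ⋯ × S_{n_r}` is generated by the `s_i` with `λ(i) = λ(i+1)`, and
`n_i = #λ⁻¹(i)`.  The algebra `Ĥ_λ ≅ Ĥ_{n_1} ⊗ ⋯ ⊗ Ĥ_{n_r}` is given by its
Bernstein presentation: generators `T_{s_i}` (`s_i ∈ W_λ`) and `Z_j^{±1}` (`1 ≤ j ≤ n`)
with the braid relations, `T_{s_i}² = 1 + (q − q⁻¹) T_{s_i}`, commuting invertible `Z_j`,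
`T_{s_i} Z_i T_{s_i} = Z_{i+1}`, and `T_{s_i} Z_j = Z_j T_{s_i}` for `j ∉ {i, i+1}`.
The isomorphism onto `1_λ Ĥ_{r,n} 1_λ = {y : 1_λ y 1_λ = y}` is realized by an injective
`𝒜`-linear multiplicative map `f` with `f 1 = 1_λ`.
-/

/-- The ground ring `𝒜 = ℤ[q,q⁻¹]`. -/
abbrev LA : Type := LaurentPolynomial ℤ

noncomputable abbrev qq : LA := LaurentPolynomial.T 1
noncomputable abbrev qqinv : LA := LaurentPolynomial.T (-1)

section

variable (r n : ℕ)

inductive HhatGen (r n : ℕ) : Type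
  | g : Fin (n - 1) → HhatGen r n
  | e : (Fin n → Fin r) → HhatGen r n
  | x : HhatGen r n
  | xinv : HhatGen r n

def Hlo {n : ℕ} (i : Fin (n - 1)) : Fin n := ⟨i.val, by omega⟩
def Hhi {n : ℕ} (i : Fin (n - 1)) : Fin n := ⟨i.val + 1, by omega⟩
def Hswap {n : ℕ} (i : Fin (n - 1)) : Equiv.Perm (Fin n) := Equiv.swap (Hlo i) (Hhi i)

open FreeAlgebra in
inductive HhatRel : FreeAlgebra LA (HhatGen r n) → FreeAlgebra LA (HhatGen r n) → Prop
  | gg (i j : Fin (n - 1)) (hij : i.val + 2 ≤ j.val ∨ j.val + 2 ≤ i.val) :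
      HhatRel (ι LA (HhatGen.g i) * ι LA (HhatGen.g j)) (ι LA (HhatGen.g j) * ι LA (HhatGen.g i))
  | braid (i j : Fin (n - 1)) (hij : j.val = i.val + 1) :
      HhatRel (ι LA (HhatGen.g i) * ι LA (HhatGen.g j) * ι LA (HhatGen.g i))
        (ι LA (HhatGen.g j) * ι LA (HhatGen.g i) * ι LA (HhatGen.g j))
  | ge (i : Fin (n - 1)) (lam : Fin n → Fin r) :
      HhatRel (ι LA (HhatGen.g i) * ι LA (HhatGen.e lam))
        (ι LA (HhatGen.e (lam ∘ (Hswap i))) * ι LA (HhatGen.g i))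
  | sum_e : HhatRel (∑ lam : Fin n → Fin r, ι LA (HhatGen.e lam)) 1
  | orth (lam lam' : Fin n → Fin r) :
      HhatRel (ι LA (HhatGen.e lam) * ι LA (HhatGen.e lam'))
        (if lam = lam' then ι LA (HhatGen.e lam) else 0)
  | quad (i : Fin (n - 1)) :
      HhatRel (ι LA (HhatGen.g i) ^ 2)
        (1 + (qq - qqinv) •
          ∑ lam ∈ Finset.univ.filter (fun lam : Fin n → Fin r => lam ∘ (Hswap i) = lam),
            ι LA (HhatGen.g i) * ι LA (HhatGen.e lam))
  | x_xinv : HhatRel (ι LA (HhatGen.x (r := r) (n := n)) * ι LA HhatGen.xinv) 1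
  | xinv_x : HhatRel (ι LA (HhatGen.xinv (r := r) (n := n)) * ι LA HhatGen.x) 1
  | gxgx (i : Fin (n - 1)) (hi : i.val = 0) :
      HhatRel (ι LA (HhatGen.g i) * ι LA HhatGen.x * ι LA (HhatGen.g i) * ι LA HhatGen.x)
        (ι LA HhatGen.x * ι LA (HhatGen.g i) * ι LA HhatGen.x * ι LA (HhatGen.g i))
  | gx (i : Fin (n - 1)) (hi : 1 ≤ i.val) :
      HhatRel (ι LA (HhatGen.g i) * ι LA HhatGen.x) (ι LA HhatGen.x * ι LA (HhatGen.g i))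
  | xe (lam : Fin n → Fin r) :
      HhatRel (ι LA HhatGen.x * ι LA (HhatGen.e lam)) (ι LA (HhatGen.e lam) * ι LA HhatGen.x)

noncomputable abbrev HhatYH := RingQuot (HhatRel r n)

noncomputable def Hg (i : Fin (n - 1)) : HhatYH r n :=
  RingQuot.mkAlgHom LA _ (FreeAlgebra.ι LA (HhatGen.g i))

noncomputable def He (lam : Fin n → Fin r) : HhatYH r n :=
  RingQuot.mkAlgHom LA _ (FreeAlgebra.ι LA (HhatGen.e lam))

noncomputable def Hx : HhatYH r n :=
  RingQuot.mkAlgHom LA _ (FreeAlgebra.ι LA HhatGen.x)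

noncomputable def HXs : ℕ → HhatYH r n
  | 0 => Hx r n
  | j + 1 =>
      if h : j < n - 1 then Hg r n ⟨j, h⟩ * HXs j * Hg r n ⟨j, h⟩ else 1

/-! ### The Bernstein presentation of `Ĥ_λ ≅ Ĥ_{n_1} ⊗ ⋯ ⊗ Ĥ_{n_r}` -/

variable (lam : Fin n → Fin r)

/-- Generators of `Ĥ_λ`: `T_{s_i}` for the simple reflections `s_i ∈ W_λ`, and `Z_j^{±1}`. -/
inductive BGen (r n : ℕ) (lam : Fin n → Fin r) : Type
  | T : {i : Fin (n - 1) // lam (Hlo i) = lam (Hhi i)} → BGen r n lam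
  | Z : Fin n → BGen r n lam
  | Zinv : Fin n → BGen r n lam

open FreeAlgebra in
/-- The defining relations of `Ĥ_λ` (Bernstein presentation). -/
inductive BRel : FreeAlgebra LA (BGen r n lam) → FreeAlgebra LA (BGen r n lam) → Prop
  | TT (i j) (hij : i.1.val + 2 ≤ j.1.val ∨ j.1.val + 2 ≤ i.1.val) :
      BRel (ι LA (BGen.T (lam := lam) i) * ι LA (BGen.T j))
        (ι LA (BGen.T j) * ι LA (BGen.T i))
  | braid (i j) (hij : j.1.val = i.1.val + 1) :
      BRel (ι LA (BGen.T (lam := lam) i) * ι LA (BGen.T j) * ι LA (BGen.T i))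
        (ι LA (BGen.T j) * ι LA (BGen.T i) * ι LA (BGen.T j))
  | quad (i) :
      BRel (ι LA (BGen.T (lam := lam) i) ^ 2) (1 + (qq - qqinv) • ι LA (BGen.T i))
  | Z_Zinv (j : Fin n) : BRel (ι LA (BGen.Z (lam := lam) j) * ι LA (BGen.Zinv j)) 1
  | Zinv_Z (j : Fin n) : BRel (ι LA (BGen.Zinv (lam := lam) j) * ι LA (BGen.Z j)) 1
  | ZZ (j j' : Fin n) :
      BRel (ι LA (BGen.Z (lam := lam) j) * ι LA (BGen.Z j'))
        (ι LA (BGen.Z j') * ι LA (BGen.Z j))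
  | TZT (i) :
      BRel (ι LA (BGen.T (lam := lam) i) * ι LA (BGen.Z (Hlo i.1)) * ι LA (BGen.T i))
        (ι LA (BGen.Z (Hhi i.1)))
  | TZ (i) (j : Fin n) (hj : j.val ≠ i.1.val ∧ j.val ≠ i.1.val + 1) :
      BRel (ι LA (BGen.T (lam := lam) i) * ι LA (BGen.Z j))
        (ι LA (BGen.Z j) * ι LA (BGen.T i))

/-- The algebra `Ĥ_λ ≅ Ĥ_{n_1} ⊗ ⋯ ⊗ Ĥ_{n_r}`. -/
noncomputable abbrev BAlg := RingQuot (BRel r n lam)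

noncomputable def BT (i : {i : Fin (n - 1) // lam (Hlo i) = lam (Hhi i)}) : BAlg r n lam :=
  RingQuot.mkAlgHom LA _ (FreeAlgebra.ι LA (BGen.T i))

noncomputable def BZ (j : Fin n) : BAlg r n lam :=
  RingQuot.mkAlgHom LA _ (FreeAlgebra.ι LA (BGen.Z j))

end


section StmtEleven

variable {r n : ℕ}

/-! ### Combinatorics of simple transpositions -/

lemma Hlo_ne_Hhi (i : Fin (n - 1)) : Hlo i ≠ Hhi i := by
  intro h
  have := congrArg Fin.val h
  simp [Hlo, Hhi] at this

lemma Hswap_lo (i : Fin (n - 1)) : Hswap i (Hlo i) = Hhi i := Equiv.swap_apply_left _ _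
lemma Hswap_hi (i : Fin (n - 1)) : Hswap i (Hhi i) = Hlo i := Equiv.swap_apply_right _ _
lemma Hswap_of_ne (i : Fin (n - 1)) (j : Fin n) (h1 : j.val ≠ i.val) (h2 : j.val ≠ i.val + 1) :
    Hswap i j = j := by
  apply Equiv.swap_apply_of_ne_of_ne
  · intro h; apply h1; rw [h]; rfl
  · intro h; apply h2; rw [h]; rfl

lemma Hswap_Hswap (i : Fin (n - 1)) (j : Fin n) : Hswap i (Hswap i j) = j := by
  simp [Hswap]

lemma comp_swap_swap {α : Type*} (μ : Fin n → α) (i : Fin (n - 1)) :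
    (μ ∘ Hswap i) ∘ Hswap i = μ := by
  funext j; simp [Hswap_Hswap]

lemma comp_swap_eq_iff {α : Type*} (μ : Fin n → α) (i : Fin (n - 1)) :
    μ ∘ Hswap i = μ ↔ μ (Hlo i) = μ (Hhi i) := by
  constructor
  · intro h
    have := congrFun h (Hhi i)
    simpa [Hswap_hi] using this
  · intro h
    funext j
    by_cases h1 : j = Hlo i
    · subst h1; simp [Hswap_lo, h]
    by_cases h2 : j = Hhi i
    · subst h2; simp [Hswap_hi, h]
    simp [Hswap, Equiv.swap_apply_of_ne_of_ne h1 h2]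

lemma Hswap_comm (i j : Fin (n - 1)) (hij : i.val + 2 ≤ j.val ∨ j.val + 2 ≤ i.val) :
    Hswap i * Hswap j = Hswap j * Hswap i := by
  apply Equiv.Perm.Disjoint.commute
  intro k
  by_cases h1 : k.val = i.val
  · right; apply Hswap_of_ne <;> omega
  by_cases h2 : k.val = i.val + 1
  · right; apply Hswap_of_ne <;> omega
  left; exact Hswap_of_ne _ _ h1 h2

/-- For `j = i + 1` the high position of `i` is the low position of `j`. -/
lemma Hhi_eq_Hlo {i j : Fin (n - 1)} (hij : j.val = i.val + 1) : Hhi i = Hlo j := by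
  apply Fin.ext; simp [Hhi, Hlo, hij]

lemma Hswap_braid (i j : Fin (n - 1)) (hij : j.val = i.val + 1) :
    Hswap i * Hswap j * Hswap i = Hswap j * Hswap i * Hswap j := by
  have h1 := Hhi_eq_Hlo hij
  have a : Hswap i (Hhi j) = Hhi j := by apply Hswap_of_ne <;> simp [Hhi] <;> omega
  have b : Hswap j (Hlo i) = Hlo i := by apply Hswap_of_ne <;> simp [Hlo] <;> omega
  have c := Hswap_lo i
  have d := Hswap_hi i
  have e := Hswap_lo j
  have f := Hswap_hi j
  rw [h1] at c d
  ext1 k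
  by_cases k1 : k = Hlo i
  · subst k1; simp [a, b, c, d, e, f]
  by_cases k2 : k = Hlo j
  · subst k2; simp [a, b, c, d, e, f]
  by_cases k3 : k = Hhi j
  · subst k3; simp [a, b, c, d, e, f]
  have k4 : Hswap i k = k := Equiv.swap_apply_of_ne_of_ne k1 (by rw [h1]; exact k2)
  have k5 : Hswap j k = k := Equiv.swap_apply_of_ne_of_ne k2 k3
  simp [k4, k5]

/-! ### Relations in `Ĥ_{r,n}` -/

noncomputable def Hxinv (r n : ℕ) : HhatYH r n :=
  RingQuot.mkAlgHom LA _ (FreeAlgebra.ι LA HhatGen.xinv)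

lemma Hgg (i j : Fin (n - 1)) (hij : i.val + 2 ≤ j.val ∨ j.val + 2 ≤ i.val) :
    Hg r n i * Hg r n j = Hg r n j * Hg r n i := by
  simpa [Hg] using RingQuot.mkAlgHom_rel LA (HhatRel.gg (r := r) i j hij)

lemma Hbraid (i j : Fin (n - 1)) (hij : j.val = i.val + 1) :
    Hg r n i * Hg r n j * Hg r n i = Hg r n j * Hg r n i * Hg r n j := by
  simpa [Hg] using RingQuot.mkAlgHom_rel LA (HhatRel.braid (r := r) i j hij)

lemma Hge (i : Fin (n - 1)) (mu : Fin n → Fin r) :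
    Hg r n i * He r n mu = He r n (mu ∘ Hswap i) * Hg r n i := by
  simpa [Hg, He] using RingQuot.mkAlgHom_rel LA (HhatRel.ge (r := r) i mu)

lemma Hsum_e : ∑ mu : Fin n → Fin r, He r n mu = 1 := by
  simpa [He] using RingQuot.mkAlgHom_rel LA (HhatRel.sum_e (r := r) (n := n))

lemma Horth (mu nu : Fin n → Fin r) :
    He r n mu * He r n nu = if mu = nu then He r n mu else 0 := by
  have := RingQuot.mkAlgHom_rel LA (HhatRel.orth (r := r) (n := n) mu nu)
  split_ifs with h
  · simpa [He, h] using this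
  · simpa [He, h] using this

lemma Hee (mu : Fin n → Fin r) : He r n mu * He r n mu = He r n mu := by simp [Horth]

/-- The sum of the idempotents fixed by `s_i`. -/
noncomputable def HE (r n : ℕ) (i : Fin (n - 1)) : HhatYH r n :=
  ∑ mu ∈ Finset.univ.filter (fun mu : Fin n → Fin r => mu ∘ (Hswap i) = mu), He r n mu

lemma Hquad (i : Fin (n - 1)) :
    Hg r n i * Hg r n i = 1 + (qq - qqinv) • (Hg r n i * HE r n i) := by
  have := RingQuot.mkAlgHom_rel LA (HhatRel.quad (r := r) i)
  rw [← pow_two, HE, Finset.mul_sum]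
  simpa only [Hg, He, map_pow, map_add, map_one, map_smul, map_sum, map_mul] using this

lemma HgE (i : Fin (n - 1)) : Hg r n i * HE r n i = HE r n i * Hg r n i := by
  rw [HE, Finset.mul_sum, Finset.sum_mul]
  apply Finset.sum_congr rfl
  intro mu hmu
  rw [Hge, (Finset.mem_filter.1 hmu).2]

lemma HEe (i : Fin (n - 1)) (mu : Fin n → Fin r) :
    HE r n i * He r n mu = if mu (Hlo i) = mu (Hhi i) then He r n mu else 0 := by
  rw [HE, Finset.sum_mul]
  simp only [Horth, Finset.sum_filter, ← comp_swap_eq_iff]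
  have : ∀ a : Fin n → Fin r, (if a ∘ Hswap i = a then if a = mu then He r n a else 0 else 0) =
      if a = mu then (if mu ∘ Hswap i = mu then He r n mu else 0) else 0 := by
    intro a
    by_cases h : a = mu
    · subst h; simp
    · simp [h]
  simp [this]

lemma Hgge_ne (i : Fin (n - 1)) (mu : Fin n → Fin r) (h : mu (Hlo i) ≠ mu (Hhi i)) :
    Hg r n i * Hg r n i * He r n mu = He r n mu := by
  rw [Hquad, add_mul, smul_mul_assoc, mul_assoc, HEe]; simp [h]

lemma Hgge_eq (i : Fin (n - 1)) (mu : Fin n → Fin r) (h : mu (Hlo i) = mu (Hhi i)) :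
    Hg r n i * Hg r n i * He r n mu = He r n mu + (qq - qqinv) • (Hg r n i * He r n mu) := by
  rw [Hquad, add_mul, smul_mul_assoc, mul_assoc, HEe]; simp [h]

lemma Hg_isUnit (i : Fin (n - 1)) : IsUnit (Hg r n i) := by
  refine ⟨⟨Hg r n i, Hg r n i + (qqinv - qq) • HE r n i, ?_, ?_⟩, rfl⟩
  · rw [mul_add, Hquad, mul_smul_comm, add_assoc, ← add_smul]; simp
  · rw [add_mul, Hquad, smul_mul_assoc, HgE, add_assoc, ← add_smul]; simp

lemma Hx_xinv : Hx r n * Hxinv r n = 1 := by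
  simpa [Hx, Hxinv] using RingQuot.mkAlgHom_rel LA (HhatRel.x_xinv (r := r) (n := n))
lemma Hxinv_x : Hxinv r n * Hx r n = 1 := by
  simpa [Hx, Hxinv] using RingQuot.mkAlgHom_rel LA (HhatRel.xinv_x (r := r) (n := n))
lemma Hgxgx (i : Fin (n - 1)) (hi : i.val = 0) :
    Hg r n i * Hx r n * Hg r n i * Hx r n = Hx r n * Hg r n i * Hx r n * Hg r n i := by
  simpa [Hx, Hg] using RingQuot.mkAlgHom_rel LA (HhatRel.gxgx (r := r) i hi)
lemma Hgx (i : Fin (n - 1)) (hi : 1 ≤ i.val) : Hg r n i * Hx r n = Hx r n * Hg r n i := by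
  simpa [Hx, Hg] using RingQuot.mkAlgHom_rel LA (HhatRel.gx (r := r) i hi)
lemma Hxe (mu : Fin n → Fin r) : Hx r n * He r n mu = He r n mu * Hx r n := by
  simpa [Hx, He] using RingQuot.mkAlgHom_rel LA (HhatRel.xe (r := r) mu)

lemma HXs_succ (i : Fin (n - 1)) :
    HXs r n (i.val + 1) = Hg r n i * HXs r n i.val * Hg r n i := by
  simp [HXs]

lemma HXs_succ_of_ge (j : ℕ) (h : ¬ j < n - 1) : HXs r n (j + 1) = 1 := by
  simp [HXs, h]

lemma HXs_isUnit (j : ℕ) : IsUnit (HXs r n j) := by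
  induction j with
  | zero => exact ⟨⟨Hx r n, Hxinv r n, Hx_xinv, Hxinv_x⟩, rfl⟩
  | succ j ih =>
    by_cases h : j < n - 1
    · rw [HXs_succ (⟨j, h⟩ : Fin (n - 1))]
      exact ((Hg_isUnit _).mul ih).mul (Hg_isUnit _)
    · rw [HXs_succ_of_ge _ h]; exact isUnit_one

lemma HXs_e (j : ℕ) (mu : Fin n → Fin r) :
    HXs r n j * He r n mu = He r n mu * HXs r n j := by
  induction j generalizing mu with
  | zero => exact Hxe mu
  | succ j ih =>
    by_cases h : j < n - 1
    · rw [HXs_succ (⟨j, h⟩ : Fin (n - 1))]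
      rw [mul_assoc, Hge, ← mul_assoc, mul_assoc (Hg r n _), ih, ← mul_assoc, Hge, comp_swap_swap]
      simp only [mul_assoc]
    · rw [HXs_succ_of_ge _ h]; simp

lemma HgX_lt (j : ℕ) (i : Fin (n - 1)) (hj : j < i.val) :
    Commute (Hg r n i) (HXs r n j) := by
  induction j with
  | zero => exact Hgx i hj
  | succ j ih =>
    have h : j < n - 1 := by omega
    rw [HXs_succ (⟨j, h⟩ : Fin (n - 1))]
    have h1 : Commute (Hg r n i) (Hg r n ⟨j, h⟩) := Hgg _ _ (Or.inr (by simp; omega))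
    exact (h1.mul_right (ih (by omega))).mul_right h1

lemma HgX_gt (j : ℕ) (i : Fin (n - 1)) (hj : i.val + 1 < j) :
    Commute (Hg r n i) (HXs r n j) := by
  induction j, hj using Nat.le_induction with
  | base =>
    by_cases h : i.val + 1 < n - 1
    · have e1 := HXs_succ (r := r) (⟨i.val + 1, h⟩ : Fin (n - 1))
      have e2 := HXs_succ (r := r) i
      have e3 : Commute (Hg r n ⟨i.val + 1, h⟩) (HXs r n i.val) := HgX_lt _ _ (by simp)
      have e4 := Hbraid (r := r) i ⟨i.val + 1, h⟩ rfl
      simp only at e1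
      show Commute _ (HXs r n (i.val + 1 + 1))
      rw [e1, e2]
      generalize Hg r n ⟨i.val + 1, h⟩ = b at *
      generalize Hg r n i = a at *
      generalize HXs r n i.val = x at *
      show a * (b * (a * x * a) * b) = (b * (a * x * a) * b) * a
      calc a * (b * (a * x * a) * b) = (a * b * a) * x * a * b := by noncomm_ring
        _ = b * a * (b * x) * a * b := by rw [e4]; noncomm_ring
        _ = b * a * x * (b * a * b) := by rw [e3.eq]; noncomm_ring
        _ = _ := by rw [← e4]; noncomm_ring
    · show Commute _ (HXs r n (i.val + 1 + 1))
      rw [HXs_succ_of_ge _ h]; exact Commute.one_right _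
  | succ j hj ih =>
    by_cases h : j < n - 1
    · rw [HXs_succ (⟨j, h⟩ : Fin (n - 1))]
      have h1 : Commute (Hg r n i) (Hg r n ⟨j, h⟩) := Hgg _ _ (Or.inl (by simp; omega))
      exact (h1.mul_right ih).mul_right h1
    · rw [HXs_succ_of_ge _ h]; exact Commute.one_right _

lemma HgX (j : ℕ) (i : Fin (n - 1)) (h1 : j ≠ i.val) (h2 : j ≠ i.val + 1) :
    Hg r n i * HXs r n j = HXs r n j * Hg r n i := by
  rcases lt_or_gt_of_ne h1 with h | h
  · exact HgX_lt j i h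
  · exact HgX_gt j i (by omega)

lemma HxX (k : ℕ) (hk : 0 < k) : Commute (Hx r n) (HXs r n k) := by
  induction k, hk using Nat.le_induction with
  | base =>
    by_cases h : 0 < n - 1
    · have := HXs_succ (r := r) (⟨0, h⟩ : Fin (n - 1))
      simp only at this
      show Commute _ (HXs r n (0 + 1))
      rw [this]
      have e := Hgxgx (r := r) (⟨0, h⟩ : Fin (n - 1)) rfl
      show Hx r n * (_ * Hx r n * _) = (_ * Hx r n * _) * Hx r n
      rw [e]; simp only [mul_assoc]
    · show Commute _ (HXs r n (0 + 1))
      rw [HXs_succ_of_ge _ h]; exact Commute.one_right _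
  | succ j hj ih =>
    by_cases h : j < n - 1
    · rw [HXs_succ (⟨j, h⟩ : Fin (n - 1))]
      have h1 : Commute (Hx r n) (Hg r n ⟨j, h⟩) := (Hgx ⟨j, h⟩ hj).symm
      exact (h1.mul_right ih).mul_right h1
    · rw [HXs_succ_of_ge _ h]; exact Commute.one_right _

lemma HXX_lt (j k : ℕ) (hk : j < k) : Commute (HXs r n j) (HXs r n k) := by
  induction j with
  | zero => exact HxX k hk
  | succ j ih =>
    by_cases h : j < n - 1
    · rw [HXs_succ (⟨j, h⟩ : Fin (n - 1))]
      have h1 : Commute (Hg r n ⟨j, h⟩) (HXs r n k) := HgX_gt _ _ (by simpa using hk)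
      exact (h1.mul_left (ih (by omega))).mul_left h1
    · rw [HXs_succ_of_ge _ h]; exact Commute.one_left _

lemma HXX (j k : ℕ) : HXs r n j * HXs r n k = HXs r n k * HXs r n j := by
  rcases lt_trichotomy j k with h | h | h
  · exact HXX_lt j k h
  · rw [h]
  · exact (HXX_lt k j h).symm

/-! ### The algebra `Ĥ_λ` -/

section Balg

variable (lam : Fin n → Fin r)

noncomputable def BZi (j : Fin n) : BAlg r n lam :=
  RingQuot.mkAlgHom LA _ (FreeAlgebra.ι LA (BGen.Zinv j))

variable {lam}

lemma BTT (i j : {i : Fin (n - 1) // lam (Hlo i) = lam (Hhi i)})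
    (hij : i.1.val + 2 ≤ j.1.val ∨ j.1.val + 2 ≤ i.1.val) :
    BT r n lam i * BT r n lam j = BT r n lam j * BT r n lam i := by
  simpa [BT] using RingQuot.mkAlgHom_rel LA (BRel.TT (r := r) (lam := lam) i j hij)
lemma Bbraid (i j : {i : Fin (n - 1) // lam (Hlo i) = lam (Hhi i)})
    (hij : j.1.val = i.1.val + 1) :
    BT r n lam i * BT r n lam j * BT r n lam i =
      BT r n lam j * BT r n lam i * BT r n lam j := by
  simpa [BT] using RingQuot.mkAlgHom_rel LA (BRel.braid (r := r) (lam := lam) i j hij)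
lemma Bquad (i : {i : Fin (n - 1) // lam (Hlo i) = lam (Hhi i)}) :
    BT r n lam i * BT r n lam i = 1 + (qq - qqinv) • BT r n lam i := by
  have := RingQuot.mkAlgHom_rel LA (BRel.quad (r := r) (lam := lam) i)
  rw [← pow_two]
  simpa only [BT, map_pow, map_add, map_one, map_smul] using this
lemma BZ_Zi (j : Fin n) : BZ r n lam j * BZi lam j = 1 := by
  simpa [BZ, BZi] using RingQuot.mkAlgHom_rel LA (BRel.Z_Zinv (r := r) (lam := lam) j)
lemma BZi_Z (j : Fin n) : BZi lam j * BZ r n lam j = 1 := by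
  simpa [BZ, BZi] using RingQuot.mkAlgHom_rel LA (BRel.Zinv_Z (r := r) (lam := lam) j)
lemma BZZ (j k : Fin n) : BZ r n lam j * BZ r n lam k = BZ r n lam k * BZ r n lam j := by
  simpa [BZ] using RingQuot.mkAlgHom_rel LA (BRel.ZZ (r := r) (lam := lam) j k)
lemma BTZT (i : {i : Fin (n - 1) // lam (Hlo i) = lam (Hhi i)}) :
    BT r n lam i * BZ r n lam (Hlo i.1) * BT r n lam i = BZ r n lam (Hhi i.1) := by
  simpa [BZ, BT] using RingQuot.mkAlgHom_rel LA (BRel.TZT (r := r) (lam := lam) i)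
lemma BTZ (i : {i : Fin (n - 1) // lam (Hlo i) = lam (Hhi i)}) (j : Fin n)
    (hj : j.val ≠ i.1.val ∧ j.val ≠ i.1.val + 1) :
    BT r n lam i * BZ r n lam j = BZ r n lam j * BT r n lam i := by
  simpa [BZ, BT] using RingQuot.mkAlgHom_rel LA (BRel.TZ (r := r) (lam := lam) i j hj)

lemma BAlg_induction {P : BAlg r n lam → Prop}
    (hs : ∀ a : LA, P (algebraMap LA _ a))
    (hT : ∀ i, P (BT r n lam i)) (hZ : ∀ j, P (BZ r n lam j)) (hZi : ∀ j, P (BZi lam j))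
    (hadd : ∀ x y, P x → P y → P (x + y)) (hmul : ∀ x y, P x → P y → P (x * y))
    (x : BAlg r n lam) : P x := by
  obtain ⟨a, rfl⟩ := RingQuot.mkAlgHom_surjective LA (BRel r n lam) x
  induction a using FreeAlgebra.induction with
  | grade0 a => simpa using hs a
  | grade1 g =>
    cases g with
    | T i => exact hT i
    | Z i => exact hZ i
    | Zinv i => exact hZi i
  | mul x y hx hy => rw [map_mul]; exact hmul _ _ hx hy
  | add x y hx hy => rw [map_add]; exact hadd _ _ hx hy

lemma HhatYH_induction {P : HhatYH r n → Prop}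
    (hs : ∀ a : LA, P (algebraMap LA _ a))
    (hg : ∀ i, P (Hg r n i)) (he : ∀ j, P (He r n j)) (hx : P (Hx r n)) (hxi : P (Hxinv r n))
    (hadd : ∀ x y, P x → P y → P (x + y)) (hmul : ∀ x y, P x → P y → P (x * y))
    (x : HhatYH r n) : P x := by
  obtain ⟨a, rfl⟩ := RingQuot.mkAlgHom_surjective LA (HhatRel r n) x
  induction a using FreeAlgebra.induction with
  | grade0 a => simpa using hs a
  | grade1 g =>
    cases g with
    | g i => exact hg i
    | e i => exact he i
    | x => exact hx
    | xinv => exact hxi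
  | mul x y hx hy => rw [map_mul]; exact hmul _ _ hx hy
  | add x y hx hy => rw [map_add]; exact hadd _ _ hx hy

/-! ### The homomorphism -/

variable (lam)

/-- The complementary idempotent of `1_λ`. -/
noncomputable def Hec : HhatYH r n :=
  ∑ mu ∈ Finset.univ.filter (fun mu : Fin n → Fin r => mu ≠ lam), He r n mu

lemma He_add_Hec : He r n lam + Hec lam = 1 := by
  rw [← Hsum_e, Hec, ← Finset.sum_filter_add_sum_filter_not Finset.univ (fun mu => mu = lam)]
  congr 1
  simp [Finset.filter_eq']

lemma He_Hec : He r n lam * Hec lam = 0 := by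
  rw [Hec, Finset.mul_sum]
  apply Finset.sum_eq_zero
  intro mu hmu
  rw [Horth, if_neg]
  exact fun h => (Finset.mem_filter.1 hmu).2 h.symm

lemma Hec_He : Hec lam * He r n lam = 0 := by
  rw [Hec, Finset.sum_mul]
  apply Finset.sum_eq_zero
  intro mu hmu
  rw [Horth, if_neg]
  exact fun h => (Finset.mem_filter.1 hmu).2 h

lemma Hec_Hec : Hec lam * Hec lam = Hec lam := by
  calc Hec lam * Hec lam = He r n lam * Hec lam + Hec lam * Hec lam := by simp [He_Hec]
    _ = _ := by rw [← add_mul, He_add_Hec, one_mul]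

/-- Elements of the corner, extended by a scalar on the complementary idempotent. -/
noncomputable def HL (c : HhatYH r n) (a : LA) : HhatYH r n := c + a • Hec lam

lemma HL_mul (c d : HhatYH r n) (a b : LA) (hc : c * He r n lam = c) (hd : He r n lam * d = d) :
    HL lam c a * HL lam d b = HL lam (c * d) (a * b) := by
  have h1 : c * Hec lam = 0 := by rw [← hc, mul_assoc, He_Hec, mul_zero]
  have h2 : Hec lam * d = 0 := by rw [← hd, ← mul_assoc, Hec_He, zero_mul]
  simp only [HL, add_mul, mul_add, mul_smul_comm, smul_mul_assoc, h1, h2, Hec_Hec, smul_zero,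
    add_zero, zero_add, smul_smul]
  rw [mul_comm b a]

lemma HL_one : HL lam (He r n lam) 1 = 1 := by
  simp [HL, He_add_Hec]

lemma HL_mul_e (c : HhatYH r n) (a : LA) (hc : c * He r n lam = c) :
    HL lam c a * He r n lam = c := by
  simp [HL, add_mul, Hec_He, hc]

lemma e_mul_HL (c : HhatYH r n) (a : LA) (hc : He r n lam * c = c) :
    He r n lam * HL lam c a = c := by
  simp [HL, mul_add, He_Hec, hc]

/-- The inverse of `X_j`. -/
noncomputable def HXi (r n : ℕ) (j : ℕ) : HhatYH r n := ((HXs_isUnit (r := r) (n := n) j).unit⁻¹ : _)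

lemma HXs_HXi (j : ℕ) : HXs r n j * HXi r n j = 1 := IsUnit.mul_val_inv _
lemma HXi_HXs (j : ℕ) : HXi r n j * HXs r n j = 1 := IsUnit.val_inv_mul _
lemma HXi_e (j : ℕ) (mu : Fin n → Fin r) :
    HXi r n j * He r n mu = He r n mu * HXi r n j := by
  calc HXi r n j * He r n mu = HXi r n j * (He r n mu * HXs r n j) * HXi r n j := by
        rw [mul_assoc, mul_assoc, HXs_HXi, mul_one]
    _ = _ := by rw [← HXs_e, ← mul_assoc, HXi_HXs, one_mul]

lemma Hge_fix (i : {i : Fin (n - 1) // lam (Hlo i) = lam (Hhi i)}) :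
    Hg r n i.1 * He r n lam = He r n lam * Hg r n i.1 := by
  rw [Hge, (comp_swap_eq_iff _ _).2 i.2]

/-- Product of two corner elements `a 1_λ`, `b 1_λ` with `b` commuting with `1_λ`. -/
lemma corner_mul (a b : HhatYH r n) (hb : b * He r n lam = He r n lam * b) :
    (a * He r n lam) * (b * He r n lam) = a * b * He r n lam := by
  rw [hb, mul_assoc, ← mul_assoc (He r n lam), Hee, ← hb, mul_assoc]

lemma corner_r (a : HhatYH r n) : (a * He r n lam) * He r n lam = a * He r n lam := by
  rw [mul_assoc, Hee]
lemma corner_l (a : HhatYH r n) (ha : a * He r n lam = He r n lam * a) :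
    He r n lam * (a * He r n lam) = a * He r n lam := by
  rw [ha, ← mul_assoc, Hee]

/-- Elements commuting with `1_λ`, paired with scalars. -/
noncomputable def HM (a : HhatYH r n) (s : LA) : HhatYH r n := HL lam (a * He r n lam) s

lemma HM_mul (a b : HhatYH r n) (s t : LA) (hb : b * He r n lam = He r n lam * b) :
    HM lam a s * HM lam b t = HM lam (a * b) (s * t) := by
  rw [HM, HM, HL_mul _ _ _ _ _ (corner_r _ _) (corner_l _ _ hb), corner_mul _ _ _ hb]; rfl

lemma HM_one : HM lam 1 1 = 1 := by rw [HM, one_mul, HL_one]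

noncomputable def FGen : BGen r n lam → HhatYH r n
  | BGen.T i => HM lam (Hg r n i.1) qq
  | BGen.Z j => HM lam (HXs r n j.val) (qq ^ (2 * j.val))
  | BGen.Zinv j => HM lam (HXi r n j.val) (qqinv ^ (2 * j.val))

lemma qq_qqinv : qq * qqinv = 1 := by
  rw [← LaurentPolynomial.T_add]; simp

lemma FGen_rel ⦃x y : FreeAlgebra LA (BGen r n lam)⦄ (h : BRel r n lam x y) :
    FreeAlgebra.lift LA (FGen lam) x = FreeAlgebra.lift LA (FGen lam) y := by
  have hg := Hge_fix (r := r) lam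
  have hX := fun j => HXs_e (r := r) (n := n) j lam
  have hXi := fun j => HXi_e (r := r) (n := n) j lam
  induction h with
  | TT i j hij =>
    simp only [map_mul, FreeAlgebra.lift_ι_apply, FGen]
    rw [HM_mul _ _ _ _ _ (hg _), HM_mul _ _ _ _ _ (hg _), Hgg _ _ hij]
  | braid i j hij =>
    simp only [map_mul, FreeAlgebra.lift_ι_apply, FGen]
    rw [HM_mul _ _ _ _ _ (hg _), HM_mul _ _ _ _ _ (hg _), HM_mul _ _ _ _ _ (hg _),
      HM_mul _ _ _ _ _ (hg _), Hbraid _ _ hij]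
  | quad i =>
    simp only [map_pow, map_add, map_one, map_smul, FreeAlgebra.lift_ι_apply, FGen]
    rw [pow_two, HM_mul _ _ _ _ _ (hg _), HM, Hgge_eq _ _ i.2, ← He_add_Hec lam, HM, HL, HL]
    have : qq * qq = 1 + (qq - qqinv) * qq := by
      linear_combination qq_qqinv
    rw [this, smul_add, add_smul, one_smul, smul_smul]
    abel
  | Z_Zinv j =>
    simp only [map_mul, map_one, FreeAlgebra.lift_ι_apply, FGen]
    rw [HM_mul _ _ _ _ _ (hXi _), HXs_HXi, ← mul_pow, qq_qqinv, one_pow, HM_one]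
  | Zinv_Z j =>
    simp only [map_mul, map_one, FreeAlgebra.lift_ι_apply, FGen]
    rw [HM_mul _ _ _ _ _ (hX _), HXi_HXs, ← mul_pow, mul_comm qqinv, qq_qqinv, one_pow, HM_one]
  | ZZ j k =>
    simp only [map_mul, FreeAlgebra.lift_ι_apply, FGen]
    rw [HM_mul _ _ _ _ _ (hX _), HM_mul _ _ _ _ _ (hX _), HXX, mul_comm (qq ^ _)]
  | TZT i =>
    simp only [map_mul, FreeAlgebra.lift_ι_apply, FGen]
    rw [HM_mul _ _ _ _ _ (hX _), HM_mul _ _ _ _ _ (hg _)]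
    have := HXs_succ (r := r) i.1
    simp only [Hlo, Hhi]
    rw [this]
    congr 1
    ring
  | TZ i j hj =>
    simp only [map_mul, FreeAlgebra.lift_ι_apply, FGen]
    rw [HM_mul _ _ _ _ _ (hX _), HM_mul _ _ _ _ _ (hg _), HgX _ _ hj.1 hj.2, mul_comm qq]

noncomputable def FHom : BAlg r n lam →ₐ[LA] HhatYH r n :=
  RingQuot.liftAlgHom LA ⟨FreeAlgebra.lift LA (FGen lam), FGen_rel lam⟩

lemma FHom_T (i) : FHom lam (BT r n lam i) = HM lam (Hg r n i.1) qq := by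
  rw [FHom, BT, RingQuot.liftAlgHom_mkAlgHom_apply, FreeAlgebra.lift_ι_apply]; rfl
lemma FHom_Z (j) : FHom lam (BZ r n lam j) = HM lam (HXs r n j.val) (qq ^ (2 * j.val)) := by
  rw [FHom, BZ, RingQuot.liftAlgHom_mkAlgHom_apply, FreeAlgebra.lift_ι_apply]; rfl
lemma FHom_Zi (j) : FHom lam (BZi lam j) = HM lam (HXi r n j.val) (qqinv ^ (2 * j.val)) := by
  rw [FHom, BZi, RingQuot.liftAlgHom_mkAlgHom_apply, FreeAlgebra.lift_ι_apply]; rfl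

lemma HM_mul_e (a : HhatYH r n) (s : LA) : HM lam a s * He r n lam = a * He r n lam :=
  HL_mul_e _ _ _ (corner_r _ _)

lemma HM_comm (a : HhatYH r n) (s : LA) (ha : a * He r n lam = He r n lam * a) :
    HM lam a s * He r n lam = He r n lam * HM lam a s := by
  rw [HM_mul_e, HM, e_mul_HL _ _ _ (corner_l _ _ ha)]

lemma FHom_comm (b : BAlg r n lam) :
    FHom lam b * He r n lam = He r n lam * FHom lam b := by
  induction b using BAlg_induction with
  | hs a => rw [AlgHom.commutes]; exact Algebra.commutes _ _
  | hT i => rw [FHom_T]; exact HM_comm _ _ _ (Hge_fix _ _)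
  | hZ j => rw [FHom_Z]; exact HM_comm _ _ _ (HXs_e _ _)
  | hZi j => rw [FHom_Zi]; exact HM_comm _ _ _ (HXi_e _ _)
  | hadd x y hx hy => rw [map_add, add_mul, mul_add, hx, hy]
  | hmul x y hx hy => rw [map_mul, mul_assoc, hy, ← mul_assoc, hx, mul_assoc]

noncomputable def fmap : BAlg r n lam →ₗ[LA] HhatYH r n where
  toFun b := FHom lam b * He r n lam
  map_add' x y := by rw [map_add, add_mul]
  map_smul' a x := by rw [map_smul, smul_mul_assoc]; rfl

lemma fmap_apply (b : BAlg r n lam) : fmap lam b = FHom lam b * He r n lam := rfl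
lemma fmap_one : fmap lam 1 = He r n lam := by rw [fmap_apply, map_one, one_mul]
lemma fmap_mul (x y : BAlg r n lam) : fmap lam (x * y) = fmap lam x * fmap lam y := by
  rw [fmap_apply, fmap_apply, fmap_apply, corner_mul _ _ _ (FHom_comm _ _), map_mul]
lemma fmap_T (i) : fmap lam (BT r n lam i) = Hg r n i.1 * He r n lam := by
  rw [fmap_apply, FHom_T, HM_mul_e]
lemma fmap_Z (j) : fmap lam (BZ r n lam j) = HXs r n j.val * He r n lam := by
  rw [fmap_apply, FHom_Z, HM_mul_e]
lemma e_fmap (b : BAlg r n lam) : He r n lam * fmap lam b = fmap lam b := by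
  rw [fmap_apply, corner_l _ _ (FHom_comm _ _)]
lemma fmap_e (b : BAlg r n lam) : fmap lam b * He r n lam = fmap lam b := by
  rw [fmap_apply, corner_r]

end Balg

/-! ### A faithful enough representation of `Ĥ_{r,n}` -/

section Rep

variable (lam : Fin n → Fin r)

/-- Minimal length coset representatives for `W_λ`. -/
def Orb : Type :=
  {p : Equiv.Perm (Fin n) // ∀ j k : Fin n, j < k → lam (p j) = lam (p k) → p j < p k}

variable {lam}

lemma Hswap_lt_aux (i : Fin (n - 1)) (j k : Fin n) (hjk : j < k) :
    Hswap i j < Hswap i k ∨ (j = Hlo i ∧ k = Hhi i) := by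
  by_cases j1 : j = Hlo i
  · by_cases k2 : k = Hhi i
    · exact Or.inr ⟨j1, k2⟩
    left
    have k1 : k ≠ Hlo i := fun h => by rw [h, j1] at hjk; exact lt_irrefl _ hjk
    rw [j1, Hswap_lo, Hswap, Equiv.swap_apply_of_ne_of_ne k1 k2]
    have := Fin.val_ne_of_ne k2
    rw [j1] at hjk
    simp only [Hlo, Hhi, Fin.lt_def] at *
    omega
  left
  by_cases j2 : j = Hhi i
  · have k1 : k ≠ Hlo i := fun h => by
      rw [h, j2] at hjk; simp only [Hlo, Hhi, Fin.lt_def] at hjk; omega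
    have k2 : k ≠ Hhi i := fun h => by rw [h, j2] at hjk; exact lt_irrefl _ hjk
    rw [j2, Hswap_hi, Hswap, Equiv.swap_apply_of_ne_of_ne k1 k2]
    rw [j2] at hjk
    simp only [Hlo, Hhi, Fin.lt_def] at *
    omega
  have e : Hswap i j = j := Equiv.swap_apply_of_ne_of_ne j1 j2
  rw [e]
  have h1 := Fin.val_ne_of_ne j1
  have h2 := Fin.val_ne_of_ne j2
  by_cases k1 : k = Hlo i
  · rw [k1] at hjk ⊢
    rw [Hswap_lo]
    simp only [Hlo, Hhi, Fin.lt_def] at *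
    omega
  by_cases k2 : k = Hhi i
  · rw [k2] at hjk ⊢
    rw [Hswap_hi]
    simp only [Hlo, Hhi, Fin.lt_def] at *
    omega
  rwa [Hswap, Equiv.swap_apply_of_ne_of_ne k1 k2]

/-- Multiplication of a minimal representative by `s_i`. -/
def Orb.sw (p : Orb lam) (i : Fin (n - 1)) (h : lam (p.1 (Hlo i)) ≠ lam (p.1 (Hhi i))) :
    Orb lam :=
  ⟨p.1 * Hswap i, by
    intro j k hjk hl
    rcases Hswap_lt_aux i j k hjk with h1 | ⟨rfl, rfl⟩
    · exact p.2 _ _ h1 hl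
    · simp only [Equiv.Perm.mul_apply, Hswap_lo, Hswap_hi] at hl
      exact absurd hl.symm h⟩

lemma Orb.sw_apply (p : Orb lam) (i : Fin (n - 1))
    (h : lam (p.1 (Hlo i)) ≠ lam (p.1 (Hhi i))) (j : Fin n) :
    (p.sw i h).1 j = p.1 (Hswap i j) := rfl

lemma Orb.key (hdom : Monotone lam) (p : Orb lam) (i : Fin (n - 1))
    (h : lam (p.1 (Hlo i)) = lam (p.1 (Hhi i))) :
    ∃ a : {i : Fin (n - 1) // lam (Hlo i) = lam (Hhi i)},
      p.1 (Hlo i) = Hlo a.1 ∧ p.1 (Hhi i) = Hhi a.1 := by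
  have hlt : Hlo i < Hhi i := by simp [Hlo, Hhi, Fin.lt_def]
  have h1 := p.2 _ _ hlt h
  have h2 : (p.1 (Hhi i)).val = (p.1 (Hlo i)).val + 1 := by
    by_contra hne
    have hlt' := Fin.lt_def.1 h1
    have hb := (p.1 (Hhi i)).isLt
    let m : Fin n := ⟨(p.1 (Hlo i)).val + 1, by omega⟩
    have m1 : p.1 (Hlo i) < m := by simp [m, Fin.lt_def]
    have m2 : m < p.1 (Hhi i) := by simp only [m, Fin.lt_def]; omega
    obtain ⟨l, hl⟩ := p.1.surjective m
    have e1 : lam (p.1 (Hlo i)) = lam (p.1 l) := by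
      rw [hl]
      exact le_antisymm (hdom m1.le) (by rw [h]; exact hdom m2.le)
    have l1 : l ≠ Hlo i := by rintro rfl; rw [hl] at m1; exact lt_irrefl _ m1
    have l2 : l ≠ Hhi i := by rintro rfl; rw [hl] at m2; exact lt_irrefl _ m2
    rcases lt_or_gt_of_ne l1 with h3 | h3
    · have := p.2 _ _ h3 e1.symm
      rw [hl] at this
      exact lt_asymm this m1
    · have h4 : Hhi i < l := by
        have := Fin.val_ne_of_ne l2
        simp only [Hlo, Hhi, Fin.lt_def] at *
        omega
      have := p.2 _ _ h4 (h.symm.trans e1)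
      rw [hl] at this
      exact lt_asymm this m2
  have hb := (p.1 (Hhi i)).isLt
  have e1 : p.1 (Hlo i) = Hlo (⟨(p.1 (Hlo i)).val, by omega⟩ : Fin (n - 1)) := rfl
  have e2 : p.1 (Hhi i) = Hhi (⟨(p.1 (Hlo i)).val, by omega⟩ : Fin (n - 1)) := Fin.ext h2
  exact ⟨⟨⟨(p.1 (Hlo i)).val, by omega⟩, by rw [← e1, ← e2]; exact h⟩, e1, e2⟩

variable (lam)

open Classical in
/-- `T_a` indexed by its low position. -/
noncomputable def TT' (a : Fin n) : BAlg r n lam :=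
  if h : ∃ i : {i : Fin (n - 1) // lam (Hlo i) = lam (Hhi i)}, Hlo i.1 = a
    then BT r n lam h.choose else 0

lemma TT'_lo (i : {i : Fin (n - 1) // lam (Hlo i) = lam (Hhi i)}) :
    TT' lam (Hlo i.1) = BT r n lam i := by
  have h : ∃ j : {i : Fin (n - 1) // lam (Hlo i) = lam (Hhi i)}, Hlo j.1 = Hlo i.1 := ⟨i, rfl⟩
  rw [TT', dif_pos h]
  congr 1
  apply Subtype.ext
  apply Fin.ext
  have := congrArg Fin.val h.choose_spec
  exact this

abbrev RepM : Type := Orb lam → BAlg r n lam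

noncomputable def opG (i : Fin (n - 1)) : Module.End LA (RepM lam) where
  toFun v := fun p =>
    if h : lam (p.1 (Hlo i)) = lam (p.1 (Hhi i)) then TT' lam (p.1 (Hlo i)) * v p
    else v (p.sw i h)
  map_add' v w := by
    funext p
    by_cases h : lam (p.1 (Hlo i)) = lam (p.1 (Hhi i)) <;> simp [h, mul_add]
  map_smul' a v := by
    funext p
    by_cases h : lam (p.1 (Hlo i)) = lam (p.1 (Hhi i)) <;> simp [h]

noncomputable def opE (mu : Fin n → Fin r) : Module.End LA (RepM lam) where
  toFun v := fun p => if lam ∘ p.1 = mu then v p else 0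
  map_add' v w := by
    funext p
    by_cases h : lam ∘ p.1 = mu <;> simp [h]
  map_smul' a v := by
    funext p
    by_cases h : lam ∘ p.1 = mu <;> simp [h]

/-- Pointwise left multiplication. -/
noncomputable def opD (b : Orb lam → BAlg r n lam) : Module.End LA (RepM lam) where
  toFun v := fun p => b p * v p
  map_add' v w := by
    funext p
    simp [mul_add]
  map_smul' a v := by
    funext p
    simp

variable {lam}

lemma opG_eq (i : Fin (n - 1)) (v : RepM lam) (p : Orb lam)
    (h : lam (p.1 (Hlo i)) = lam (p.1 (Hhi i))) :
    opG lam i v p = TT' lam (p.1 (Hlo i)) * v p := by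
  simp [opG, h]

lemma opG_ne (i : Fin (n - 1)) (v : RepM lam) (p : Orb lam)
    (h : lam (p.1 (Hlo i)) ≠ lam (p.1 (Hhi i))) :
    opG lam i v p = v (p.sw i h) := by
  simp [opG, h]

lemma opE_apply (mu : Fin n → Fin r) (v : RepM lam) (p : Orb lam) :
    opE lam mu v p = if lam ∘ p.1 = mu then v p else 0 := rfl

lemma opD_apply (b : Orb lam → BAlg r n lam) (v : RepM lam) (p : Orb lam) :
    opD lam b v p = b p * v p := rfl

lemma opGG (hdom : Monotone lam) (i j : Fin (n - 1))
    (hij : i.val + 2 ≤ j.val ∨ j.val + 2 ≤ i.val) (v : RepM lam) :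
    opG lam i (opG lam j v) = opG lam j (opG lam i v) := by
  funext p
  have a1 : Hswap i (Hlo j) = Hlo j := by apply Hswap_of_ne <;> simp [Hlo] <;> omega
  have a2 : Hswap i (Hhi j) = Hhi j := by apply Hswap_of_ne <;> simp [Hhi] <;> omega
  have a3 : Hswap j (Hlo i) = Hlo i := by apply Hswap_of_ne <;> simp [Hlo] <;> omega
  have a4 : Hswap j (Hhi i) = Hhi i := by apply Hswap_of_ne <;> simp [Hhi] <;> omega
  by_cases hi : lam (p.1 (Hlo i)) = lam (p.1 (Hhi i)) <;>
  by_cases hj : lam (p.1 (Hlo j)) = lam (p.1 (Hhi j))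
  · rw [opG_eq _ _ _ hi, opG_eq _ _ _ hj, opG_eq _ _ _ hj, opG_eq _ _ _ hi, ← mul_assoc,
      ← mul_assoc]
    obtain ⟨a, ha, ha'⟩ := p.key hdom i hi
    obtain ⟨b, hb, hb'⟩ := p.key hdom j hj
    rw [ha, hb, TT'_lo, TT'_lo, BTT]
    have n1 : p.1 (Hlo i) ≠ p.1 (Hlo j) := by
      intro h; have := congrArg Fin.val (p.1.injective h); simp [Hlo] at this; omega
    have n2 : p.1 (Hlo i) ≠ p.1 (Hhi j) := by
      intro h; have := congrArg Fin.val (p.1.injective h); simp [Hlo, Hhi] at this; omega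
    have n3 : p.1 (Hhi i) ≠ p.1 (Hlo j) := by
      intro h; have := congrArg Fin.val (p.1.injective h); simp [Hlo, Hhi] at this; omega
    rw [ha, hb] at n1
    rw [ha, hb'] at n2
    rw [ha', hb] at n3
    have n1 := Fin.val_ne_of_ne n1
    have n2 := Fin.val_ne_of_ne n2
    have n3 := Fin.val_ne_of_ne n3
    simp only [Hlo, Hhi] at n1 n2 n3
    omega
  · rw [opG_eq _ _ _ hi, opG_ne _ _ _ hj, opG_ne _ _ _ hj, opG_eq, Orb.sw_apply, a3]
    rw [Orb.sw_apply, Orb.sw_apply, a3, a4]; exact hi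
  · rw [opG_eq _ _ _ hj, opG_ne _ _ _ hi, opG_ne _ _ _ hi, opG_eq, Orb.sw_apply, a1]
    rw [Orb.sw_apply, Orb.sw_apply, a1, a2]; exact hj
  · rw [opG_ne _ _ _ hi, opG_ne _ _ _ hj, opG_ne, opG_ne]
    · congr 1
      apply Subtype.ext
      show p.1 * Hswap i * Hswap j = p.1 * Hswap j * Hswap i
      rw [mul_assoc, Hswap_comm i j hij, mul_assoc]
    · rw [Orb.sw_apply, Orb.sw_apply, a3, a4]; exact hi
    · rw [Orb.sw_apply, Orb.sw_apply, a1, a2]; exact hj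

lemma opBraid (hdom : Monotone lam) (i j : Fin (n - 1)) (hij : j.val = i.val + 1)
    (v : RepM lam) :
    opG lam i (opG lam j (opG lam i v)) = opG lam j (opG lam i (opG lam j v)) := by
  funext p
  have h0 := Hhi_eq_Hlo hij
  have a1 : Hswap i (Hhi j) = Hhi j := by apply Hswap_of_ne <;> simp [Hhi] <;> omega
  have a2 : Hswap j (Hlo i) = Hlo i := by apply Hswap_of_ne <;> simp [Hlo] <;> omega
  have a3 := Hswap_lo i
  have a4 := Hswap_hi i
  have a5 := Hswap_lo j
  have a6 := Hswap_hi j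
  rw [h0] at a3 a4
  have hperm := Hswap_braid i j hij
  by_cases hxy : lam (p.1 (Hlo i)) = lam (p.1 (Hlo j)) <;>
  by_cases hyz : lam (p.1 (Hlo j)) = lam (p.1 (Hhi j))
  · have hi : lam (p.1 (Hlo i)) = lam (p.1 (Hhi i)) := by rw [h0]; exact hxy
    obtain ⟨a, ha, ha'⟩ := p.key hdom i hi
    obtain ⟨b, hb, hb'⟩ := p.key hdom j hyz
    have hab : b.1.val = a.1.val + 1 := by
      rw [h0, hb] at ha'
      exact congrArg Fin.val ha'
    simp only [opG_eq _ _ _ hi, opG_eq _ _ _ hyz, ha, hb, TT'_lo, ← mul_assoc]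
    rw [Bbraid a b hab]
  · have hi : lam (p.1 (Hlo i)) = lam (p.1 (Hhi i)) := by rw [h0]; exact hxy
    rw [opG_eq _ _ _ hi, opG_ne _ _ _ hyz, opG_ne _ _ _ hyz]
    have n1 : lam ((p.sw j hyz).1 (Hlo i)) ≠ lam ((p.sw j hyz).1 (Hhi i)) := by
      simp only [Orb.sw_apply, h0, a1, a2, a3, a4, a5, a6]; rw [hxy]; exact hyz
    rw [opG_ne _ _ _ n1, opG_ne _ _ _ n1, opG_eq]
    · simp only [Orb.sw_apply, h0, a1, a2, a3, a4, a5, a6]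
    · simp only [Orb.sw_apply, h0, a1, a2, a3, a4, a5, a6]; exact hxy
  · have hi : lam (p.1 (Hlo i)) ≠ lam (p.1 (Hhi i)) := by rw [h0]; exact hxy
    rw [opG_eq _ _ _ hyz, opG_ne _ _ _ hi, opG_ne _ _ _ hi]
    have n1 : lam ((p.sw i hi).1 (Hlo j)) ≠ lam ((p.sw i hi).1 (Hhi j)) := by
      simp only [Orb.sw_apply, h0, a1, a2, a3, a4, a5, a6]; rw [← hyz]; exact hxy
    rw [opG_ne _ _ _ n1, opG_ne _ _ _ n1, opG_eq]
    · simp only [Orb.sw_apply, h0, a1, a2, a3, a4, a5, a6]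
    · simp only [Orb.sw_apply, h0, a1, a2, a3, a4, a5, a6]; exact hyz
  · have hi : lam (p.1 (Hlo i)) ≠ lam (p.1 (Hhi i)) := by rw [h0]; exact hxy
    rw [opG_ne _ _ _ hi, opG_ne _ _ _ hyz]
    by_cases hxz : lam (p.1 (Hlo i)) = lam (p.1 (Hhi j))
    · have n1 : lam ((p.sw i hi).1 (Hlo j)) = lam ((p.sw i hi).1 (Hhi j)) := by
        simp only [Orb.sw_apply, h0, a1, a2, a3, a4, a5, a6]; exact hxz
      have n2 : lam ((p.sw j hyz).1 (Hlo i)) = lam ((p.sw j hyz).1 (Hhi i)) := by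
        simp only [Orb.sw_apply, h0, a1, a2, a3, a4, a5, a6]; exact hxz
      rw [opG_eq _ _ _ n1, opG_eq _ _ _ n2, opG_ne, opG_ne]
      · simp only [Orb.sw_apply, h0, a1, a2, a3, a4, a5, a6]
        congr 2
        apply Subtype.ext
        show p.1 * Hswap i * Hswap i = p.1 * Hswap j * Hswap j
        simp [mul_assoc, Hswap]
      · simp only [Orb.sw_apply, h0, a1, a2, a3, a4, a5, a6]; exact Ne.symm hyz
      · simp only [Orb.sw_apply, h0, a1, a2, a3, a4, a5, a6]; exact Ne.symm hxy
    · have n1 : lam ((p.sw i hi).1 (Hlo j)) ≠ lam ((p.sw i hi).1 (Hhi j)) := by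
        simp only [Orb.sw_apply, h0, a1, a2, a3, a4, a5, a6]; exact hxz
      have n2 : lam ((p.sw j hyz).1 (Hlo i)) ≠ lam ((p.sw j hyz).1 (Hhi i)) := by
        simp only [Orb.sw_apply, h0, a1, a2, a3, a4, a5, a6]; exact hxz
      rw [opG_ne _ _ _ n1, opG_ne _ _ _ n2, opG_ne, opG_ne]
      · congr 1
        apply Subtype.ext
        show p.1 * Hswap i * Hswap j * Hswap i = p.1 * Hswap j * Hswap i * Hswap j
        rw [mul_assoc, mul_assoc, ← mul_assoc (Hswap i), hperm]
        simp only [mul_assoc]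
      · simp only [Orb.sw_apply, h0, a1, a2, a3, a4, a5, a6]; exact hxy
      · simp only [Orb.sw_apply, h0, a1, a2, a3, a4, a5, a6]; exact hyz

lemma opGE (i : Fin (n - 1)) (mu : Fin n → Fin r) (v : RepM lam) :
    opG lam i (opE lam mu v) = opE lam (mu ∘ Hswap i) (opG lam i v) := by
  funext p
  by_cases hi : lam (p.1 (Hlo i)) = lam (p.1 (Hhi i))
  · have h := (comp_swap_eq_iff (lam ∘ p.1) i).2 hi
    rw [opG_eq _ _ _ hi, opE_apply, opE_apply, opG_eq _ _ _ hi, mul_ite, mul_zero]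
    refine if_congr ?_ rfl rfl
    constructor
    · rintro rfl; exact h.symm
    · intro h'; rw [← comp_swap_swap mu i, ← h', h]
  · rw [opG_ne _ _ _ hi, opE_apply, opE_apply, opG_ne _ _ _ hi]
    refine if_congr ?_ rfl rfl
    have : lam ∘ (p.sw i hi).1 = (lam ∘ p.1) ∘ Hswap i := rfl
    rw [this]
    constructor
    · intro h; rw [← h, comp_swap_swap]
    · intro h; rw [h, comp_swap_swap]

lemma opQuad (hdom : Monotone lam) (i : Fin (n - 1)) (v : RepM lam) :
    opG lam i (opG lam i v) = v + (qq - qqinv) • ∑ mu ∈ Finset.univ.filter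
      (fun mu : Fin n → Fin r => mu ∘ (Hswap i) = mu), opG lam i (opE lam mu v) := by
  funext p
  rw [← map_sum]
  simp only [Pi.add_apply, Pi.smul_apply]
  by_cases hi : lam (p.1 (Hlo i)) = lam (p.1 (Hhi i))
  · have h := (comp_swap_eq_iff (lam ∘ p.1) i).2 hi
    obtain ⟨a, ha, ha'⟩ := p.key hdom i hi
    rw [opG_eq _ _ _ hi, opG_eq _ _ _ hi, opG_eq _ _ _ hi, ← mul_assoc, ha, TT'_lo, Bquad,
      Finset.sum_apply]
    simp only [opE_apply]
    rw [Finset.sum_ite_eq, if_pos (by simpa using h), add_mul, one_mul, smul_mul_assoc]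
  · have h := fun h => hi ((comp_swap_eq_iff (lam ∘ p.1) i).1 h)
    rw [opG_ne _ _ _ hi, opG_ne _ _ _ hi, opG_ne, Finset.sum_apply]
    · simp only [opE_apply]
      rw [Finset.sum_ite_eq, if_neg]
      · rw [smul_zero, add_zero]
        congr 1
        apply Subtype.ext
        show p.1 * Hswap i * Hswap i = p.1
        simp [mul_assoc, Hswap]
      · intro h'
        simp only [Finset.mem_filter, Finset.mem_univ, true_and] at h'
        have := (comp_swap_eq_iff _ i).1 h'
        simp only [Function.comp_apply, Orb.sw_apply, Hswap_lo, Hswap_hi] at this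
        exact hi this.symm
    · simp only [Orb.sw_apply, Hswap_lo, Hswap_hi]
      exact Ne.symm hi

/-- The diagonal operator by which `X_j` acts. -/
noncomputable def opX (lam : Fin n → Fin r) (j : Fin n) : Module.End LA (RepM lam) :=
  opD lam (fun p => BZ r n lam (p.1 j))
noncomputable def opXi (lam : Fin n → Fin r) (j : Fin n) : Module.End LA (RepM lam) :=
  opD lam (fun p => BZi lam (p.1 j))

lemma opX_apply (j : Fin n) (v : RepM lam) (p : Orb lam) :
    opX lam j v p = BZ r n lam (p.1 j) * v p := rfl
lemma opXi_apply (j : Fin n) (v : RepM lam) (p : Orb lam) :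
    opXi lam j v p = BZi lam (p.1 j) * v p := rfl

lemma opGXG (hdom : Monotone lam) (i : Fin (n - 1)) (v : RepM lam) :
    opG lam i (opX lam (Hlo i) (opG lam i v)) = opX lam (Hhi i) v := by
  funext p
  by_cases hi : lam (p.1 (Hlo i)) = lam (p.1 (Hhi i))
  · obtain ⟨a, ha, ha'⟩ := p.key hdom i hi
    rw [opG_eq _ _ _ hi, opX_apply, opX_apply, opG_eq _ _ _ hi, ha, ha', TT'_lo, ← BTZT]
    simp only [mul_assoc]
  · rw [opG_ne _ _ _ hi, opX_apply, opX_apply, opG_ne]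
    · rw [Orb.sw_apply, Hswap_lo]
      congr 2
      apply Subtype.ext
      show p.1 * Hswap i * Hswap i = p.1
      simp [mul_assoc, Hswap]
    · simp only [Orb.sw_apply, Hswap_lo, Hswap_hi]
      exact Ne.symm hi

lemma opXX (j k : Fin n) (v : RepM lam) :
    opX lam j (opX lam k v) = opX lam k (opX lam j v) := by
  funext p
  simp only [opX_apply, ← mul_assoc]
  rw [BZZ]

lemma opGX (hdom : Monotone lam) (i : Fin (n - 1)) (j : Fin n) (h1 : j ≠ Hlo i) (h2 : j ≠ Hhi i)
    (v : RepM lam) :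
    opG lam i (opX lam j v) = opX lam j (opG lam i v) := by
  funext p
  by_cases hi : lam (p.1 (Hlo i)) = lam (p.1 (Hhi i))
  · obtain ⟨a, ha, ha'⟩ := p.key hdom i hi
    rw [opG_eq _ _ _ hi, opX_apply, opX_apply, opG_eq _ _ _ hi, ha, TT'_lo, ← mul_assoc,
      ← mul_assoc, BTZ]
    have n1 := fun h => h1 (p.1.injective h)
    have n2 := fun h => h2 (p.1.injective h)
    rw [ha] at n1
    rw [ha'] at n2
    exact ⟨Fin.val_ne_of_ne n1, Fin.val_ne_of_ne n2⟩
  · rw [opG_ne _ _ _ hi, opX_apply, opX_apply, opG_ne _ _ _ hi, Orb.sw_apply, Hswap,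
      Equiv.swap_apply_of_ne_of_ne h1 h2]

variable (lam)

noncomputable def RGen (hn : 1 ≤ n) : HhatGen r n → Module.End LA (RepM lam)
  | HhatGen.g i => opG lam i
  | HhatGen.e mu => opE lam mu
  | HhatGen.x => opX lam ⟨0, hn⟩
  | HhatGen.xinv => opXi lam ⟨0, hn⟩

lemma RGen_rel (hn : 1 ≤ n) (hdom : Monotone lam) ⦃x y : FreeAlgebra LA (HhatGen r n)⦄
    (h : HhatRel r n x y) :
    FreeAlgebra.lift LA (RGen lam hn) x = FreeAlgebra.lift LA (RGen lam hn) y := by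
  apply LinearMap.ext
  intro v
  induction h with
  | gg i j hij =>
    simp only [map_mul, FreeAlgebra.lift_ι_apply, RGen, Module.End.mul_apply]
    exact opGG hdom i j hij v
  | braid i j hij =>
    simp only [map_mul, FreeAlgebra.lift_ι_apply, RGen, Module.End.mul_apply]
    exact opBraid hdom i j hij v
  | ge i mu =>
    simp only [map_mul, FreeAlgebra.lift_ι_apply, RGen, Module.End.mul_apply]
    exact opGE i mu v
  | sum_e =>
    simp only [map_sum, map_one, FreeAlgebra.lift_ι_apply, RGen, LinearMap.sum_apply,
      Module.End.one_apply]
    funext p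
    rw [Finset.sum_apply]
    simp only [opE_apply]
    rw [Finset.sum_ite_eq, if_pos (Finset.mem_univ _)]
  | orth mu nu =>
    by_cases hmn : mu = nu
    · subst hmn
      simp only [map_mul, FreeAlgebra.lift_ι_apply, RGen, Module.End.mul_apply, if_true]
      funext p
      simp only [opE_apply]
      split_ifs <;> rfl
    · simp only [map_mul, FreeAlgebra.lift_ι_apply, RGen, Module.End.mul_apply, if_neg hmn,
        map_zero, LinearMap.zero_apply]
      funext p
      simp only [opE_apply, Pi.zero_apply]
      split_ifs with h1 h2
      · exact absurd (h1.symm.trans h2) hmn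
      · rfl
      · rfl
  | quad i =>
    simp only [map_pow, map_add, map_one, map_smul, map_sum, map_mul, FreeAlgebra.lift_ι_apply,
      RGen, pow_two, Module.End.mul_apply, LinearMap.add_apply, Module.End.one_apply,
      LinearMap.smul_apply, LinearMap.sum_apply]
    exact opQuad hdom i v
  | x_xinv =>
    simp only [map_mul, map_one, FreeAlgebra.lift_ι_apply, RGen, Module.End.mul_apply,
      Module.End.one_apply]
    funext p
    rw [opX_apply, opXi_apply, ← mul_assoc, BZ_Zi, one_mul]
  | xinv_x =>
    simp only [map_mul, map_one, FreeAlgebra.lift_ι_apply, RGen, Module.End.mul_apply,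
      Module.End.one_apply]
    funext p
    rw [opXi_apply, opX_apply, ← mul_assoc, BZi_Z, one_mul]
  | gxgx i hi =>
    simp only [map_mul, FreeAlgebra.lift_ι_apply, RGen, Module.End.mul_apply]
    have : (⟨0, hn⟩ : Fin n) = Hlo i := Fin.ext hi.symm
    rw [this, opGXG hdom, opGXG hdom, opXX]
  | gx i hi =>
    simp only [map_mul, FreeAlgebra.lift_ι_apply, RGen, Module.End.mul_apply]
    apply opGX hdom
    · intro h; have := congrArg Fin.val h; simp [Hlo] at this; omega
    · intro h; have := congrArg Fin.val h; simp [Hhi] at this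
  | xe mu =>
    simp only [map_mul, FreeAlgebra.lift_ι_apply, RGen, Module.End.mul_apply]
    funext p
    simp only [opE_apply, opX_apply]
    split_ifs <;> simp

noncomputable def RHom (hn : 1 ≤ n) (hdom : Monotone lam) :
    HhatYH r n →ₐ[LA] Module.End LA (RepM lam) :=
  RingQuot.liftAlgHom LA ⟨FreeAlgebra.lift LA (RGen lam hn), RGen_rel lam hn hdom⟩

variable {lam}

lemma RHom_g (hn : 1 ≤ n) (hdom : Monotone lam) (i) :
    RHom lam hn hdom (Hg r n i) = opG lam i := by
  rw [RHom, Hg, RingQuot.liftAlgHom_mkAlgHom_apply, FreeAlgebra.lift_ι_apply]; rfl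
lemma RHom_e (hn : 1 ≤ n) (hdom : Monotone lam) (mu) :
    RHom lam hn hdom (He r n mu) = opE lam mu := by
  rw [RHom, He, RingQuot.liftAlgHom_mkAlgHom_apply, FreeAlgebra.lift_ι_apply]; rfl
lemma RHom_x (hn : 1 ≤ n) (hdom : Monotone lam) :
    RHom lam hn hdom (Hx r n) = opX lam ⟨0, hn⟩ := by
  rw [RHom, Hx, RingQuot.liftAlgHom_mkAlgHom_apply, FreeAlgebra.lift_ι_apply]; rfl

lemma RHom_X (hn : 1 ≤ n) (hdom : Monotone lam) (j : ℕ) (hj : j < n) :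
    RHom lam hn hdom (HXs r n j) = opX lam ⟨j, hj⟩ := by
  induction j with
  | zero => exact RHom_x hn hdom
  | succ j ih =>
    have h : j < n - 1 := by omega
    rw [HXs_succ (⟨j, h⟩ : Fin (n - 1)), map_mul, map_mul, RHom_g, ih (by omega)]
    apply LinearMap.ext
    intro v
    exact opGXG hdom ⟨j, h⟩ v

def orb1 (lam : Fin n → Fin r) : Orb lam := ⟨1, fun _ _ h _ => h⟩

lemma RHom_fmap (hn : 1 ≤ n) (hdom : Monotone lam) (b : BAlg r n lam) (v : RepM lam) :
    RHom lam hn hdom (fmap lam b) v (orb1 lam) = b * v (orb1 lam) := by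
  have he : ∀ w : RepM lam, opE lam lam w (orb1 lam) = w (orb1 lam) := by
    intro w; rw [opE_apply, if_pos]; rfl
  have hZ : ∀ (j : Fin n) (v : RepM lam), RHom lam hn hdom (fmap lam (BZ r n lam j)) v (orb1 lam) =
      BZ r n lam j * v (orb1 lam) := by
    intro j v
    rw [fmap_Z, map_mul, RHom_X hn hdom _ j.isLt, RHom_e, Module.End.mul_apply, opX_apply, he]
    rfl
  induction b using BAlg_induction generalizing v with
  | hs a =>
    rw [Algebra.algebraMap_eq_smul_one, map_smul, fmap_one, map_smul, RHom_e, LinearMap.smul_apply,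
      Pi.smul_apply, he, smul_mul_assoc, one_mul]
  | hT i =>
    rw [fmap_T, map_mul, RHom_g, RHom_e, Module.End.mul_apply, opG_eq _ _ _ i.2, he]
    congr 1
    exact TT'_lo lam i
  | hZ j => exact hZ j v
  | hZi j =>
    have h1 := hZ j (RHom lam hn hdom (fmap lam (BZi lam j)) v)
    rw [← Module.End.mul_apply, ← map_mul, ← fmap_mul, BZ_Zi, fmap_one, RHom_e, he] at h1
    rw [h1, ← mul_assoc, BZi_Z, one_mul]
  | hadd x y hx hy => rw [map_add, map_add, LinearMap.add_apply, Pi.add_apply, hx, hy, add_mul]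
  | hmul x y hx hy => rw [fmap_mul, map_mul, Module.End.mul_apply, hx, hy, mul_assoc]

lemma fmap_injective (hn : 1 ≤ n) (hdom : Monotone lam) : Function.Injective (fmap lam) := by
  intro x y h
  have h1 := RHom_fmap hn hdom x (fun _ => 1)
  have h2 := RHom_fmap hn hdom y (fun _ => 1)
  rw [h, h2] at h1
  simpa using h1.symm

end Rep

/-! ### Surjectivity onto the corner -/

section Surj

variable (lam : Fin n → Fin r)

/-- Elements `g_{i_k} ⋯ g_{i_1} 1_λ`, where each step goes from an ascent to a descent. -/
inductive HW : ℕ → (Fin n → Fin r) → HhatYH r n → Prop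
  | base : HW 0 lam (He r n lam)
  | step (k : ℕ) (mu : Fin n → Fin r) (w : HhatYH r n) (i : Fin (n - 1)) (h : HW k mu w)
      (hi : mu (Hlo i) < mu (Hhi i)) : HW (k + 1) (mu ∘ Hswap i) (Hg r n i * w)

variable {lam}

lemma HW.e_mul {k mu w} (h : HW lam k mu w) : He r n mu * w = w := by
  induction h with
  | base => exact Hee lam
  | step k mu w i h hi ih => rw [← mul_assoc, ← Hge, mul_assoc, ih]

lemma HW.mul_e {k mu w} (h : HW lam k mu w) : w * He r n lam = w := by
  induction h with
  | base => exact Hee lam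
  | step k mu w i h hi ih => rw [mul_assoc, ih]

lemma gg_of_e {mu : Fin n → Fin r} {w : HhatYH r n} (hw : He r n mu * w = w) (i : Fin (n - 1))
    (h : mu (Hlo i) ≠ mu (Hhi i)) : Hg r n i * (Hg r n i * w) = w := by
  conv_lhs => rw [← hw]
  rw [← mul_assoc, ← mul_assoc, Hgge_ne i mu h, hw]

lemma e_g {mu : Fin n → Fin r} {w : HhatYH r n} (hw : He r n mu * w = w) (i : Fin (n - 1)) :
    He r n (mu ∘ Hswap i) * (Hg r n i * w) = Hg r n i * w := by
  rw [← mul_assoc, ← Hge, mul_assoc, hw]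

/-- The three positions involved in a braid relation. -/
lemma braid_pos {i j : Fin (n - 1)} (hij : j.val = i.val + 1) :
    Hhi i = Hlo j ∧ Hswap i (Hhi j) = Hhi j ∧ Hswap j (Hlo i) = Hlo i ∧
    Hswap i (Hlo i) = Hlo j ∧ Hswap i (Hlo j) = Hlo i ∧
    Hswap j (Hlo j) = Hhi j ∧ Hswap j (Hhi j) = Hlo j := by
  have h0 := Hhi_eq_Hlo hij
  refine ⟨h0, ?_, ?_, ?_, ?_, Hswap_lo j, Hswap_hi j⟩
  · apply Hswap_of_ne <;> simp [Hhi] <;> omega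
  · apply Hswap_of_ne <;> simp [Hlo] <;> omega
  · rw [← h0]; exact Hswap_lo i
  · rw [← h0]; exact Hswap_hi i

lemma far_pos {i j : Fin (n - 1)} (hij : i.val + 2 ≤ j.val ∨ j.val + 2 ≤ i.val) :
    Hswap i (Hlo j) = Hlo j ∧ Hswap i (Hhi j) = Hhi j ∧
    Hswap j (Hlo i) = Hlo i ∧ Hswap j (Hhi i) = Hhi i := by
  refine ⟨?_, ?_, ?_, ?_⟩
  · apply Hswap_of_ne <;> simp [Hlo] <;> omega
  · apply Hswap_of_ne <;> simp [Hhi] <;> omega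
  · apply Hswap_of_ne <;> simp [Hlo] <;> omega
  · apply Hswap_of_ne <;> simp [Hhi] <;> omega

lemma comp_perm_comm {α : Type*} (mu : Fin n → α) {i j : Fin (n - 1)}
    (hij : i.val + 2 ≤ j.val ∨ j.val + 2 ≤ i.val) :
    (mu ∘ Hswap i) ∘ Hswap j = (mu ∘ Hswap j) ∘ Hswap i := by
  have := Hswap_comm i j hij
  funext k
  exact congrArg mu (congrArg (fun f : Equiv.Perm (Fin n) => f k) this)

lemma comp_perm_braid {α : Type*} (mu : Fin n → α) {i j : Fin (n - 1)}
    (hij : j.val = i.val + 1) :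
    ((mu ∘ Hswap i) ∘ Hswap j) ∘ Hswap i = ((mu ∘ Hswap j) ∘ Hswap i) ∘ Hswap j := by
  have := Hswap_braid i j hij
  funext k
  exact congrArg mu (congrArg (fun f : Equiv.Perm (Fin n) => f k) this)

lemma index_cases (i j : Fin (n - 1)) :
    i = j ∨ (i.val + 2 ≤ j.val ∨ j.val + 2 ≤ i.val) ∨ i.val = j.val + 1 ∨ j.val = i.val + 1 := by
  by_cases h : i.val = j.val
  · exact Or.inl (Fin.ext h)
  · omega

lemma HW.desc (hdom : Monotone lam) (k : ℕ) : ∀ (mu : Fin n → Fin r) (w : HhatYH r n)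
    (i : Fin (n - 1)), HW lam k mu w → mu (Hhi i) < mu (Hlo i) →
    ∃ k', k = k' + 1 ∧ HW lam k' (mu ∘ Hswap i) (Hg r n i * w) := by
  induction k using Nat.strong_induction_on with
  | _ k IH =>
  intro mu w i hw hi
  cases hw with
  | base =>
    exfalso
    have : Hlo i ≤ Hhi i := by simp [Hlo, Hhi, Fin.le_def]
    exact absurd (hdom this) (not_le.2 hi)
  | step k nu w j hW hj =>
    refine ⟨k, rfl, ?_⟩
    rcases index_cases i j with rfl | hij | hij | hij
    · rw [comp_swap_swap, gg_of_e hW.e_mul _ hj.ne]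
      exact hW
    · obtain ⟨b1, b2, b3, b4⟩ := far_pos hij
      simp only [Function.comp_apply, b3, b4] at hi
      obtain ⟨k', rfl, hW'⟩ := IH k (by omega) nu w i hW hi
      have := HW.step _ _ _ j hW' (by simpa only [Function.comp_apply, b1, b2] using hj)
      rw [comp_perm_comm _ hij.symm, ← mul_assoc, Hgg _ _ hij, mul_assoc]
      exact this
    · obtain ⟨b1, b2, b3, b4, b5, b6, b7⟩ := braid_pos hij
      simp only [Function.comp_apply, b1, b2, b3, b4, b5, b6, b7] at hi hj
      -- now i = j + 1
      have hi' : nu (Hhi i) < nu (Hlo i) := hi.trans hj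
      obtain ⟨k', rfl, hW1⟩ := IH k (by omega) nu w i hW hi'
      obtain ⟨k'', rfl, hW2⟩ := IH k' (by omega) _ _ j hW1
        (by simpa only [Function.comp_apply, b1, b2, b3, b4, b5, b6, b7] using hi)
      have hW3 := HW.step _ _ _ i hW2
        (by simpa only [Function.comp_apply, b1, b2, b3, b4, b5, b6, b7] using hj)
      have hW4 := HW.step _ _ _ j hW3
        (by simpa only [Function.comp_apply, b1, b2, b3, b4, b5, b6, b7] using hi')
      have e1 : Hg r n i * (Hg r n j * (Hg r n i * w)) = Hg r n j * (Hg r n i * (Hg r n j * w)) := by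
        have := Hbraid (r := r) j i hij
        simp only [← mul_assoc]; rw [this]
      rw [← comp_perm_braid _ hij, comp_swap_swap, e1, gg_of_e (e_g (e_g hW.e_mul j) i)] at hW4
      · exact hW4
      · simp only [Function.comp_apply, b1, b2, b3, b4, b5, b6, b7]; exact hi'.ne'
    · obtain ⟨b1, b2, b3, b4, b5, b6, b7⟩ := braid_pos hij
      simp only [Function.comp_apply, b1, b2, b3, b4, b5, b6, b7] at hi hj
      -- now j = i + 1
      have hi' : nu (Hhi i) < nu (Hlo i) := by rw [b1]; exact hj.trans hi
      obtain ⟨k', rfl, hW1⟩ := IH k (by omega) nu w i hW hi'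
      obtain ⟨k'', rfl, hW2⟩ := IH k' (by omega) _ _ j hW1
        (by simpa only [Function.comp_apply, b1, b2, b3, b4, b5, b6, b7] using hi)
      have hW3 := HW.step _ _ _ i hW2
        (by simpa only [Function.comp_apply, b1, b2, b3, b4, b5, b6, b7] using hj)
      have hW4 := HW.step _ _ _ j hW3
        (by simpa only [Function.comp_apply, b1, b2, b3, b4, b5, b6, b7] using hi')
      have e1 : Hg r n i * (Hg r n j * (Hg r n i * w)) = Hg r n j * (Hg r n i * (Hg r n j * w)) := by
        have := Hbraid (r := r) i j hij
        simp only [← mul_assoc]; rw [this]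
      rw [comp_perm_braid _ hij, comp_swap_swap, e1, gg_of_e (e_g (e_g hW.e_mul j) i)] at hW4
      · exact hW4
      · simp only [Function.comp_apply, b1, b2, b3, b4, b5, b6, b7]; rw [b1] at hi'; exact hi'.ne'

lemma HW.flat (hdom : Monotone lam) (k : ℕ) : ∀ (mu : Fin n → Fin r) (w : HhatYH r n)
    (i : Fin (n - 1)), HW lam k mu w → mu (Hlo i) = mu (Hhi i) →
    ∃ b : BAlg r n lam, Hg r n i * w = w * fmap lam b := by
  induction k using Nat.strong_induction_on with
  | _ k IH =>
  intro mu w i hw hi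
  cases hw with
  | base =>
    refine ⟨BT r n lam ⟨i, hi⟩, ?_⟩
    rw [e_fmap, fmap_T]
  | step k nu w j hW hj =>
    rcases index_cases i j with rfl | hij | hij | hij
    · simp only [Function.comp_apply, Hswap_lo, Hswap_hi] at hi
      exact absurd hi hj.ne'
    · obtain ⟨b1, b2, b3, b4⟩ := far_pos hij
      simp only [Function.comp_apply, b3, b4] at hi
      obtain ⟨b, hb⟩ := IH k (by omega) nu w i hW hi
      refine ⟨b, ?_⟩
      rw [← mul_assoc, Hgg _ _ hij, mul_assoc, hb, mul_assoc]
    · obtain ⟨b1, b2, b3, b4, b5, b6, b7⟩ := braid_pos hij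
      simp only [Function.comp_apply, b1, b2, b3, b4, b5, b6, b7] at hi hj
      have hi' : nu (Hhi i) < nu (Hlo i) := by rw [← hi]; exact hj
      obtain ⟨k', rfl, hW1⟩ := HW.desc hdom k nu w i hW hi'
      obtain ⟨b, hb⟩ := IH k' (by omega) _ _ j hW1
        (by simpa only [Function.comp_apply, b1, b2, b3, b4, b5, b6, b7] using hi)
      refine ⟨b, ?_⟩
      have e0 := gg_of_e hW.e_mul i hi'.ne'
      have e1 := Hbraid (r := r) j i hij
      calc Hg r n i * (Hg r n j * w)
          = Hg r n i * (Hg r n j * (Hg r n i * (Hg r n i * w))) := by rw [e0]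
        _ = (Hg r n i * Hg r n j * Hg r n i) * (Hg r n i * w) := by simp only [mul_assoc]
        _ = Hg r n j * (Hg r n i * (Hg r n j * (Hg r n i * w))) := by
            rw [← e1]; simp only [mul_assoc]
        _ = Hg r n j * (Hg r n i * (Hg r n i * w)) * fmap lam b := by
            rw [hb]; simp only [mul_assoc]
        _ = _ := by rw [e0]
    · obtain ⟨b1, b2, b3, b4, b5, b6, b7⟩ := braid_pos hij
      simp only [Function.comp_apply, b1, b2, b3, b4, b5, b6, b7] at hi hj
      have hi' : nu (Hhi i) < nu (Hlo i) := by rw [b1, hi]; exact hj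
      obtain ⟨k', rfl, hW1⟩ := HW.desc hdom k nu w i hW hi'
      obtain ⟨b, hb⟩ := IH k' (by omega) _ _ j hW1
        (by simpa only [Function.comp_apply, b1, b2, b3, b4, b5, b6, b7] using hi)
      refine ⟨b, ?_⟩
      have e0 := gg_of_e hW.e_mul i hi'.ne'
      have e1 := Hbraid (r := r) i j hij
      calc Hg r n i * (Hg r n j * w)
          = Hg r n i * (Hg r n j * (Hg r n i * (Hg r n i * w))) := by rw [e0]
        _ = (Hg r n i * Hg r n j * Hg r n i) * (Hg r n i * w) := by simp only [mul_assoc]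
        _ = Hg r n j * (Hg r n i * (Hg r n j * (Hg r n i * w))) := by
            rw [e1]; simp only [mul_assoc]
        _ = Hg r n j * (Hg r n i * (Hg r n i * w)) * fmap lam b := by
            rw [hb]; simp only [mul_assoc]
        _ = _ := by rw [e0]

lemma HW.X {k mu w} (h : HW lam k mu w) :
    ∀ m : ℕ, m < n → ∃ j : Fin n, HXs r n m * w = w * fmap lam (BZ r n lam j) := by
  induction h with
  | base =>
    intro m hm
    refine ⟨⟨m, hm⟩, ?_⟩
    rw [e_fmap, fmap_Z]
  | step k mu w i h hi ih =>
    intro m hm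
    by_cases h1 : m = i.val
    · subst h1
      obtain ⟨j, hj⟩ := ih (i.val + 1) (by omega)
      refine ⟨j, ?_⟩
      rw [mul_assoc, ← hj, HXs_succ]
      have e1 : He r n (mu ∘ Hswap i) * (HXs r n i.val * (Hg r n i * w)) =
          HXs r n i.val * (Hg r n i * w) := by
        rw [← mul_assoc, ← HXs_e, mul_assoc, e_g h.e_mul]
      have e2 := gg_of_e e1 i (by
        simp only [Function.comp_apply, Hswap_lo, Hswap_hi]; exact hi.ne')
      rw [← e2]
      simp only [mul_assoc]
    by_cases h2 : m = i.val + 1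
    · subst h2
      obtain ⟨j, hj⟩ := ih i.val (by omega)
      refine ⟨j, ?_⟩
      rw [mul_assoc, ← hj, HXs_succ, mul_assoc, gg_of_e h.e_mul i hi.ne, mul_assoc]
    · obtain ⟨j, hj⟩ := ih m hm
      refine ⟨j, ?_⟩
      rw [← mul_assoc, ← HgX _ _ h1 h2, mul_assoc, hj, mul_assoc]

lemma HW.at_lam (hdom : Monotone lam) {k w} (h : HW lam k lam w) : w = He r n lam := by
  generalize hmu : lam = mu at h
  cases h with
  | base => exact hmu ▸ rfl
  | step k nu w i h hi =>
    exfalso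
    have h1 : Hlo i ≤ Hhi i := by simp [Hlo, Hhi, Fin.le_def]
    have h2 := hdom h1
    subst hmu
    simp only [Function.comp_apply, Hswap_lo, Hswap_hi] at h2
    exact absurd h2 (not_le.2 hi)

variable (lam) in
/-- The span of all `w * f(b)`. -/
noncomputable def HY : Submodule LA (HhatYH r n) :=
  Submodule.span LA {y | ∃ k mu w b, HW lam k mu w ∧ y = w * fmap lam b}

lemma HY_stable_of (y : HhatYH r n)
    (hy : ∀ k mu w, HW lam k mu w → ∃ k' mu' w' b, HW lam k' mu' w' ∧ y * w = w' * fmap lam b) :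
    ∀ z ∈ HY lam, y * z ∈ HY lam := by
  intro z hz
  induction hz using Submodule.span_induction with
  | mem z hz =>
    obtain ⟨k, mu, w, b, hW, rfl⟩ := hz
    obtain ⟨k', mu', w', b', hW', h⟩ := hy k mu w hW
    apply Submodule.subset_span
    refine ⟨k', mu', w', b' * b, hW', ?_⟩
    rw [← mul_assoc, h, fmap_mul, mul_assoc]
  | zero => rw [mul_zero]; exact Submodule.zero_mem _
  | add a b _ _ ha hb => rw [mul_add]; exact Submodule.add_mem _ ha hb
  | smul c a _ ha => rw [mul_smul_comm]; exact Submodule.smul_mem _ _ ha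

lemma HW.mul_one {k mu w} (h : HW lam k mu w) : w * fmap lam 1 = w := by
  rw [fmap_one, h.mul_e]

lemma HY_stable (hn : 1 ≤ n) (hdom : Monotone lam) (y : HhatYH r n) :
    ∀ z ∈ HY lam, y * z ∈ HY lam := by
  induction y using HhatYH_induction with
  | hs a =>
    intro z hz
    rw [← Algebra.smul_def]
    exact Submodule.smul_mem _ _ hz
  | hg i =>
    apply HY_stable_of
    intro k mu w hW
    rcases lt_trichotomy (mu (Hlo i)) (mu (Hhi i)) with h | h | h
    · have := HW.step _ _ _ i hW h
      exact ⟨_, _, _, 1, this, this.mul_one.symm⟩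
    · obtain ⟨b, hb⟩ := HW.flat hdom _ _ _ i hW h
      exact ⟨_, _, _, b, hW, hb⟩
    · obtain ⟨k', -, this⟩ := HW.desc hdom _ _ _ i hW h
      exact ⟨_, _, _, 1, this, this.mul_one.symm⟩
  | he nu =>
    apply HY_stable_of
    intro k mu w hW
    by_cases h : nu = mu
    · subst h
      exact ⟨_, _, _, 1, hW, by rw [hW.mul_one, hW.e_mul]⟩
    · refine ⟨_, _, _, 0, hW, ?_⟩
      rw [map_zero, mul_zero, ← hW.e_mul, ← mul_assoc, Horth, if_neg h, zero_mul]
  | hx =>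
    apply HY_stable_of
    intro k mu w hW
    obtain ⟨j, hj⟩ := hW.X 0 hn
    exact ⟨_, _, _, _, hW, hj⟩
  | hxi =>
    apply HY_stable_of
    intro k mu w hW
    obtain ⟨j, hj⟩ := hW.X 0 hn
    refine ⟨_, _, _, BZi lam j, hW, ?_⟩
    have hj' : Hx r n * w = w * fmap lam (BZ r n lam j) := hj
    calc Hxinv r n * w = Hxinv r n * (w * fmap lam (BZ r n lam j * BZi lam j)) := by
          rw [BZ_Zi, hW.mul_one]
      _ = Hxinv r n * (Hx r n * w) * fmap lam (BZi lam j) := by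
          rw [fmap_mul, hj']; simp only [mul_assoc]
      _ = _ := by rw [← mul_assoc, Hxinv_x, one_mul]
  | hadd x y hx hy =>
    intro z hz
    rw [add_mul]; exact Submodule.add_mem _ (hx z hz) (hy z hz)
  | hmul x y hx hy =>
    intro z hz
    rw [mul_assoc]; exact hx _ (hy z hz)

lemma e_HY (hdom : Monotone lam) (z : HhatYH r n) (hz : z ∈ HY lam) :
    ∃ b, He r n lam * z = fmap lam b := by
  induction hz using Submodule.span_induction with
  | mem z hz =>
    obtain ⟨k, mu, w, b, hW, rfl⟩ := hz
    by_cases h : lam = mu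
    · subst h
      refine ⟨b, ?_⟩
      rw [hW.at_lam hdom, e_fmap, e_fmap]
    · refine ⟨0, ?_⟩
      rw [map_zero, ← mul_assoc, ← hW.e_mul, ← mul_assoc, Horth, if_neg h, zero_mul, zero_mul]
  | zero => exact ⟨0, by simp⟩
  | add a b _ _ ha hb =>
    obtain ⟨x, hx⟩ := ha
    obtain ⟨y, hy⟩ := hb
    exact ⟨x + y, by rw [mul_add, hx, hy, map_add]⟩
  | smul c a _ ha =>
    obtain ⟨x, hx⟩ := ha
    exact ⟨c • x, by rw [mul_smul_comm, hx, map_smul]⟩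

lemma fmap_range (hn : 1 ≤ n) (hdom : Monotone lam) :
    Set.range (fmap lam) = {y : HhatYH r n | He r n lam * y * He r n lam = y} := by
  ext y
  constructor
  · rintro ⟨b, rfl⟩
    show He r n lam * fmap lam b * He r n lam = fmap lam b
    rw [e_fmap, fmap_e]
  · intro hy
    have h0 : He r n lam ∈ HY lam := Submodule.subset_span
      ⟨0, lam, _, 1, HW.base, HW.base.mul_one.symm⟩
    obtain ⟨b, hb⟩ := e_HY hdom _ (HY_stable hn hdom y _ h0)
    refine ⟨b, ?_⟩
    rw [← hb, ← mul_assoc]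
    exact hy

end Surj

end StmtEleven

theorem stmt_11 (r n : ℕ) (hr : 1 ≤ r) (hn : 1 ≤ n)
    (lam : Fin n → Fin r) (hdom : Monotone lam) :
    ∃ f : BAlg r n lam →ₗ[LA] HhatYH r n,
      f 1 = He r n lam ∧
      (∀ x y, f (x * y) = f x * f y) ∧
      (∀ i, f (BT r n lam i) = Hg r n i.1 * He r n lam) ∧
      (∀ j : Fin n, f (BZ r n lam j) = HXs r n j.val * He r n lam) ∧
      Function.Injective f ∧
      Set.range f = {y : HhatYH r n | He r n lam * y * He r n lam = y} := by
  exact ⟨fmap lam, fmap_one lam, fmap_mul lam, fmap_T lam, fmap_Z lam,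
    fmap_injective hn hdom, fmap_range hn hdom⟩
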